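/- (Asymptotic complexity of statistical decoding, real regime.) Let 0 < ω < 1/2 and 0 < τ < 1/2 − √(ω−ω²), and let r = (1−2τ − √((1−2τ)²−4ω(1−ω)))/(2(1−ω)) be the smallest root of (1−ω)X² − (1−2τ)X + ω = 0. Then π(ω,τ) = 2ω·log₂(r) − 2τ·log₂(1−r) − 2(1−τ)·log₂(1+r) + 2H(ω). -/

import Mathlib

open Finset Filter

/-- The bias of statistical decoding on an error position. -/
noncomputable def eps1 (n w t : ℕ) : ℝ :=
  (∑ j ∈ Finset.range w,
      if Even j then ((t - 1).choose j * (n - t).choose (w - 1 - j) : ℝ) else 0) /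
    ((n - 1).choose (w - 1) : ℝ) - 1 / 2

/-- The bias of statistical decoding on a non-error position. -/
noncomputable def eps0 (n w t : ℕ) : ℝ :=
  (∑ j ∈ Finset.range w,
      if Odd j then (t.choose j * (n - t - 1).choose (w - 1 - j) : ℝ) else 0) /
    ((n - 1).choose (w - 1) : ℝ) - 1 / 2

/-- The binary entropy function `H(x) = −x log₂ x − (1−x) log₂ (1−x)`. -/
noncomputable def binH (x : ℝ) : ℝ :=
  -x * Real.logb 2 x - (1 - x) * Real.logb 2 (1 - x)

/-- The asymptotic exponent of statistical decoding:
`π(ω,τ) = liminf (1/n) log₂ (1/(ε₁ − ε₀)²)` with `w = ⌊ωn⌋`, `t = ⌊τn⌋`. -/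
noncomputable def piSD (ω τ : ℝ) : ℝ :=
  Filter.liminf
    (fun n : ℕ => (1 / (n : ℝ)) *
      Real.logb 2 (1 / (eps1 n ⌊ω * n⌋₊ ⌊τ * n⌋₊ - eps0 n ⌊ω * n⌋₊ ⌊τ * n⌋₊) ^ 2))
    Filter.atTop

section Krawtchouk

open Polynomial

/-- The value at `a` of the Krawtchouk polynomial of degree `k` and length `a + b`. -/
noncomputable def krawtchouk (a b k : ℕ) : ℝ := ((1 - X) ^ a * (1 + X) ^ b : ℝ[X]).coeff k

theorem coeff_one_sub_X_pow_eq (a j : ℕ) :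
    ((1 - X) ^ a : ℝ[X]).coeff j = (-1) ^ j * (a.choose j : ℝ) := by
  have h : ((1 - X) ^ a : ℝ[X]) = ((1 + X) ^ a : ℝ[X]).comp (C (-1) * X) := by
    simp [sub_eq_add_neg]
  rw [h, comp_C_mul_X_coeff, coeff_one_add_X_pow, mul_comm]

theorem krawtchouk_eq_sum (a b k : ℕ) :
    krawtchouk a b k =
      ∑ j ∈ range (k + 1), (-1) ^ j * ((a.choose j : ℝ) * (b.choose (k - j) : ℝ)) := by
  rw [krawtchouk, coeff_mul, Finset.Nat.sum_antidiagonal_eq_sum_range_succ_mk]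
  refine sum_congr rfl fun j _ => ?_
  rw [coeff_one_sub_X_pow_eq, coeff_one_add_X_pow, mul_assoc]

theorem krawtchouk_zero_left (b k : ℕ) : krawtchouk 0 b k = b.choose k := by
  simp [krawtchouk, coeff_one_add_X_pow]

theorem krawtchouk_zero_right (a b : ℕ) : krawtchouk a b 0 = 1 := by
  simp [krawtchouk_eq_sum]

theorem choose_add_eq_sum (a b k : ℕ) :
    ((a + b).choose k : ℝ) = ∑ j ∈ range (k + 1), (a.choose j : ℝ) * (b.choose (k - j) : ℝ) := by
  rw [Nat.add_choose_eq, Finset.Nat.sum_antidiagonal_eq_sum_range_succ_mk]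
  push_cast; rfl

theorem sum_even_choose_mul_choose (a b k : ℕ) :
    (∑ j ∈ range (k + 1), if Even j then (a.choose j * b.choose (k - j) : ℝ) else 0) =
      ((a + b).choose k + krawtchouk a b k) / 2 := by
  rw [choose_add_eq_sum, krawtchouk_eq_sum, ← sum_add_distrib, sum_div]
  refine sum_congr rfl fun j _ => ?_
  split_ifs with h
  · rw [h.neg_one_pow]; ring
  · rw [(Nat.not_even_iff_odd.1 h).neg_one_pow]; ring

theorem sum_odd_choose_mul_choose (a b k : ℕ) :
    (∑ j ∈ range (k + 1), if Odd j then (a.choose j * b.choose (k - j) : ℝ) else 0) =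
      ((a + b).choose k - krawtchouk a b k) / 2 := by
  rw [choose_add_eq_sum, krawtchouk_eq_sum, ← sum_sub_distrib, sum_div]
  refine sum_congr rfl fun j _ => ?_
  split_ifs with h
  · rw [h.neg_one_pow]; ring
  · rw [(Nat.not_odd_iff_even.1 h).neg_one_pow]; ring

theorem krawtchouk_add_krawtchouk (a b k : ℕ) :
    krawtchouk a (b + 1) k + krawtchouk (a + 1) b k = 2 * krawtchouk a b k := by
  simp only [krawtchouk]
  rw [← coeff_add, ← coeff_C_mul]
  congr 1
  rw [show (C 2 : ℝ[X]) = 2 from rfl]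
  ring

theorem eps1_sub_eps0 (a b k : ℕ) (hk : k ≤ a + b + 1) :
    eps1 (a + b + 2) (k + 1) (a + 1) - eps0 (a + b + 2) (k + 1) (a + 1) =
      krawtchouk a b k / ((a + b + 1).choose k : ℝ) := by
  have hC : ((a + b + 1).choose k : ℝ) ≠ 0 := by exact_mod_cast (Nat.choose_pos hk).ne'
  have h1 := sum_even_choose_mul_choose a (b + 1) k
  have h0 := sum_odd_choose_mul_choose (a + 1) b k
  have h2 := krawtchouk_add_krawtchouk a b k
  unfold eps1 eps0
  simp only [show a + b + 2 - (a + 1) = b + 1 by omega, show a + b + 2 - 1 = a + b + 1 by omega,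
    Nat.add_sub_cancel]
  rw [h1, h0, show a + (b + 1) = a + b + 1 by ring, show a + 1 + b = a + b + 1 by ring]
  field_simp
  linear_combination h2

theorem krawtchouk_rec (a b k : ℕ) :
    ((k : ℝ) + 2) * krawtchouk a b (k + 2) =
      ((b : ℝ) - a) * krawtchouk a b (k + 1) - ((a : ℝ) + b - k) * krawtchouk a b k := by
  set P : ℝ[X] := (1 - X) ^ a * (1 + X) ^ b with hP
  have hd : derivative P - derivative P * X ^ 2 =
      C ((b : ℝ) - a) * P - C ((a : ℝ) + b) * (P * X) := by
    have ha : ((1 - X) * derivative ((1 - X) ^ a : ℝ[X])) = - C (a : ℝ) * (1 - X) ^ a := by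
      rcases a with _ | a
      · simp
      · simp [derivative_pow]; ring
    have hb : ((1 + X) * derivative ((1 + X) ^ b : ℝ[X])) = C (b : ℝ) * (1 + X) ^ b := by
      rcases b with _ | b
      · simp
      · simp [derivative_pow]; ring
    rw [hP, derivative_mul, C_sub, C_add]
    linear_combination (1 + X) ^ b * (1 + X) * ha + (1 - X) ^ a * (1 - X) * hb
  have h := congrArg (fun q => coeff q (k + 1)) hd
  simp only [coeff_sub, coeff_C_mul, coeff_mul_X] at h
  rw [coeff_derivative] at h
  simp only [krawtchouk, ← hP]
  have h2 : (derivative P * X ^ 2).coeff (k + 1) = k * P.coeff k := by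
    rw [coeff_mul_X_pow']
    rcases k with _ | k
    · simp
    · simp [coeff_derivative]; ring
  rw [h2] at h
  push_cast at h
  linear_combination h

theorem krawtchouk_one (a b : ℕ) : krawtchouk a b 1 = (b : ℝ) - a := by
  rw [krawtchouk_eq_sum]; simp [sum_range_succ]; ring

theorem norm_coeff_mul_pow_le (p : ℂ[X]) (k : ℕ) {ρ B : ℝ} (hρ : 0 < ρ)
    (hB : ∀ z ∈ Metric.sphere (0 : ℂ) ρ, ‖p.eval z‖ ≤ B) : ‖p.coeff k‖ * ρ ^ k ≤ B := by
  have hiter : ∀ (j : ℕ) (q : ℂ[X]),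
      deriv^[j] (fun z => q.eval z) = fun z => (derivative^[j] q).eval z := by
    intro j
    induction j with
    | zero => intro q; rfl
    | succ j ih =>
      intro q
      rw [Function.iterate_succ_apply, Function.iterate_succ_apply, ← ih]
      congr 1
      funext z
      exact q.deriv
  have h := Complex.norm_iteratedDeriv_le_of_forall_mem_sphere_norm_le k hρ
    p.differentiable.diffContOnCl hB
  rw [iteratedDeriv_eq_iterate, hiter] at h
  simp only [← coeff_zero_eq_eval_zero, coeff_iterate_derivative, zero_add,
    Nat.descFactorial_self, nsmul_eq_mul, norm_mul, Complex.norm_natCast] at h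
  rw [mul_div_assoc] at h
  have h' := le_of_mul_le_mul_left h (by exact_mod_cast k.factorial_pos)
  rwa [le_div_iff₀ (pow_pos hρ k)] at h'

theorem norm_one_sub_pow_mul_norm_one_add_pow_le (a b : ℕ) {ρ : ℝ} (hρ0 : 0 < ρ) (hρ1 : ρ < 1)
    (h : (a : ℝ) * (1 + ρ) ^ 2 ≤ b * (1 - ρ) ^ 2) {z : ℂ} (hz : ‖z‖ = ρ) :
    ‖1 - z‖ ^ a * ‖1 + z‖ ^ b ≤ (1 - ρ) ^ a * (1 + ρ) ^ b := by
  have hz2 : z.re ^ 2 + z.im ^ 2 = ρ ^ 2 := by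
    rw [← hz, Complex.sq_norm, Complex.normSq_apply]; ring
  have hre : z.re ≤ ρ := hz ▸ Complex.re_le_norm z
  have h1 : ‖1 - z‖ ^ 2 = (1 - ρ) ^ 2 * (2 * (ρ - z.re) / (1 - ρ) ^ 2 + 1) := by
    have : (1 - ρ) ≠ 0 := by linarith
    rw [Complex.sq_norm, Complex.normSq_apply]
    field_simp
    simp
    linear_combination hz2
  have h2 : ‖1 + z‖ ^ 2 = (1 + ρ) ^ 2 * (-(2 * (ρ - z.re) / (1 + ρ) ^ 2) + 1) := by
    have : (1 + ρ) ≠ 0 := by linarith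
    rw [Complex.sq_norm, Complex.normSq_apply]
    field_simp
    simp
    linear_combination hz2
  have h1' : ‖1 - z‖ ^ 2 ≤ (1 - ρ) ^ 2 * Real.exp (2 * (ρ - z.re) / (1 - ρ) ^ 2) := by
    rw [h1]; gcongr; exact Real.add_one_le_exp _
  have h2' : ‖1 + z‖ ^ 2 ≤ (1 + ρ) ^ 2 * Real.exp (-(2 * (ρ - z.re) / (1 + ρ) ^ 2)) := by
    rw [h2]; gcongr; exact Real.add_one_le_exp _
  have hρ : 0 < 1 - ρ := by linarith
  refine le_of_sq_le_sq ?_ (by positivity)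
  calc (‖1 - z‖ ^ a * ‖1 + z‖ ^ b) ^ 2 = (‖1 - z‖ ^ 2) ^ a * (‖1 + z‖ ^ 2) ^ b := by ring
    _ ≤ ((1 - ρ) ^ 2 * Real.exp (2 * (ρ - z.re) / (1 - ρ) ^ 2)) ^ a *
        ((1 + ρ) ^ 2 * Real.exp (-(2 * (ρ - z.re) / (1 + ρ) ^ 2))) ^ b := by gcongr
    _ = ((1 - ρ) ^ a * (1 + ρ) ^ b) ^ 2 *
        Real.exp (a * (2 * (ρ - z.re) / (1 - ρ) ^ 2) + b * -(2 * (ρ - z.re) / (1 + ρ) ^ 2)) := by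
      rw [Real.exp_add, Real.exp_nat_mul, Real.exp_nat_mul]
      simp only [mul_pow, ← pow_mul]
      ring
    _ ≤ ((1 - ρ) ^ a * (1 + ρ) ^ b) ^ 2 * 1 := by
      gcongr
      rw [Real.exp_le_one_iff]
      have : (a : ℝ) * (2 * (ρ - z.re) / (1 - ρ) ^ 2) + b * -(2 * (ρ - z.re) / (1 + ρ) ^ 2) =
          2 * (ρ - z.re) * (a * (1 + ρ) ^ 2 - b * (1 - ρ) ^ 2) / ((1 - ρ) ^ 2 * (1 + ρ) ^ 2) := by
        field_simp
        ring
      rw [this]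
      refine div_nonpos_of_nonpos_of_nonneg ?_ (by positivity)
      exact mul_nonpos_of_nonneg_of_nonpos (by linarith) (by linarith)
    _ = _ := mul_one _

theorem abs_krawtchouk_mul_pow_le (a b k : ℕ) {ρ : ℝ} (hρ0 : 0 < ρ) (hρ1 : ρ < 1)
    (h : (a : ℝ) * (1 + ρ) ^ 2 ≤ b * (1 - ρ) ^ 2) :
    |krawtchouk a b k| * ρ ^ k ≤ (1 - ρ) ^ a * (1 + ρ) ^ b := by
  have := norm_coeff_mul_pow_le (((1 - X) ^ a * (1 + X) ^ b : ℝ[X]).map Complex.ofRealHom) k hρ0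
    (B := (1 - ρ) ^ a * (1 + ρ) ^ b) (fun z hz => by
      simpa using norm_one_sub_pow_mul_norm_one_add_pow_le a b hρ0 hρ1 h (by simpa using hz))
  rw [coeff_map] at this
  simpa [krawtchouk] using this

theorem sum_krawtchouk_mul_pow (a b : ℕ) (x : ℝ) :
    ∑ k ∈ range (a + b + 1), krawtchouk a b k * x ^ k = (1 - x) ^ a * (1 + x) ^ b := by
  have hdeg : ((1 - X) ^ a * (1 + X) ^ b : ℝ[X]).natDegree < a + b + 1 := by
    have : ((1 - X) ^ a * (1 + X) ^ b : ℝ[X]).natDegree ≤ a + b := by compute_degree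
    omega
  have h := eval_eq_sum_range' hdeg x
  simp only [eval_mul, eval_pow, eval_sub, eval_add, eval_one, eval_X] at h
  exact h.symm

theorem krawtchouk_ratio {a b : ℕ} {c κ : ℝ} (hc : 1 ≤ c) (hκ : κ ≤ a + b)
    (h : ((a : ℝ) + b + 2) / c + κ * (c - 1 / c) ≤ b - a) (k : ℕ) (hk : (k : ℝ) + 1 ≤ κ) :
    0 < krawtchouk a b k ∧ c * krawtchouk a b k ≤ krawtchouk a b (k + 1) ∧
      ((k : ℝ) + 1) * krawtchouk a b (k + 1) ≤ (a + b) * krawtchouk a b k := by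
  have hc' : 0 ≤ c - 1 / c := by
    rw [sub_nonneg, div_le_iff₀ (by linarith)]; nlinarith
  induction k with
  | zero =>
    have h1 : 0 < ((a : ℝ) + b + 1) / c := by positivity
    have h2 : 1 * (c - 1 / c) ≤ κ * (c - 1 / c) := by gcongr; simpa using hk
    have h3 : ((a : ℝ) + b + 2) / c = ((a : ℝ) + b + 1) / c + 1 / c := by ring
    have ha : (0 : ℝ) ≤ a := a.cast_nonneg
    rw [krawtchouk_zero_right, zero_add, krawtchouk_one]
    refine ⟨one_pos, ?_, ?_⟩ <;> push_cast <;> linarith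
  | succ k ih =>
    push_cast at hk ⊢
    obtain ⟨hpos, hlow, -⟩ := ih (by linarith)
    have hpos' : 0 < krawtchouk a b (k + 1) := by nlinarith
    have hN : 0 ≤ (a : ℝ) + b - k := by linarith
    have hrec := krawtchouk_rec a b k
    have ha : (0 : ℝ) ≤ a := a.cast_nonneg
    have h1 : krawtchouk a b k ≤ krawtchouk a b (k + 1) / c := by
      rw [le_div_iff₀ (by linarith)]; linarith
    have h2 : ((k : ℝ) + 2) * (c - 1 / c) ≤ κ * (c - 1 / c) := by gcongr; linarith
    refine ⟨hpos', ?_, ?_⟩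
    · have h3 : c * ((k : ℝ) + 2) ≤ (b - a) - ((a : ℝ) + b - k) / c := by
        have : ((a : ℝ) + b - k) / c = ((a : ℝ) + b + 2) / c - (k + 2) * (1 / c) := by ring
        linarith
      have h4 : ((a : ℝ) + b - k) * krawtchouk a b k ≤
          ((a : ℝ) + b - k) * (krawtchouk a b (k + 1) / c) := by gcongr
      have h5 := mul_le_mul_of_nonneg_right h3 hpos'.le
      have h6 : ((k : ℝ) + 2) * (c * krawtchouk a b (k + 1)) ≤
          ((k : ℝ) + 2) * krawtchouk a b (k + 2) := by
        rw [hrec]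
        have : ((a : ℝ) + b - k) * (krawtchouk a b (k + 1) / c) =
          ((a : ℝ) + b - k) / c * krawtchouk a b (k + 1) := by ring
        linarith
      exact le_of_mul_le_mul_left h6 (by positivity)
    · have : 0 ≤ ((a : ℝ) + b - k) * krawtchouk a b k := by positivity
      have : 0 ≤ (a : ℝ) * krawtchouk a b (k + 1) := by positivity
      rw [show (k : ℝ) + 1 + 1 = k + 2 by ring, hrec]
      linarith

theorem krawtchouk_mul_pow_le {a b m L : ℕ} {c r D : ℝ} (hc : 1 ≤ c)
    (hκ : (m : ℝ) + L + 1 ≤ a + b)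
    (h : ((a : ℝ) + b + 2) / c + (m + L + 1) * (c - 1 / c) ≤ b - a)
    (hr0 : 0 < r) (hr1 : r ≤ 1) (hDr : 1 ≤ D * r) (hDm : (a : ℝ) + b ≤ D * (m + 1))
    {k : ℕ} (hkm : k ≤ m + L) (hmk : m ≤ k + L) :
    krawtchouk a b k * r ^ k ≤ krawtchouk a b m * r ^ m * D ^ L := by
  have hratio := krawtchouk_ratio hc hκ h
  have hD : 1 ≤ D := by
    have : 0 < D := by by_contra!; nlinarith
    nlinarith
  have hpos : ∀ i ≤ m + L, 0 < krawtchouk a b i := fun i hi =>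
    (hratio i (by have : (i : ℝ) ≤ m + L := by exact_mod_cast hi
                  linarith)).1
  rcases le_total m k with hle | hle
  · obtain ⟨i, rfl⟩ := Nat.exists_eq_add_of_le hle
    have hup : ∀ j ≤ i, krawtchouk a b (m + j) ≤ krawtchouk a b m * D ^ j := by
      intro j
      induction j with
      | zero => simp
      | succ j ih =>
        intro hj
        have h0 := hpos (m + j) (by omega)
        have hj' : ((m + j : ℕ) : ℝ) + 1 ≤ m + L + 1 := by
          have : ((m + j : ℕ) : ℝ) ≤ ((m + L : ℕ) : ℝ) := by exact_mod_cast (by omega)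
          push_cast at this ⊢; linarith
        have h1 := (hratio (m + j) hj').2.2
        have h2 : (a : ℝ) + b ≤ D * (((m + j : ℕ) : ℝ) + 1) := by
          push_cast
          nlinarith [(Nat.cast_nonneg j : (0 : ℝ) ≤ j)]
        have h3 : (((m + j : ℕ) : ℝ) + 1) * krawtchouk a b (m + j + 1) ≤
            (((m + j : ℕ) : ℝ) + 1) * (D * krawtchouk a b (m + j)) := by
          nlinarith [mul_le_mul_of_nonneg_right h2 h0.le]
        have h4 := le_of_mul_le_mul_left h3 (by positivity)
        rw [← add_assoc, pow_succ]
        nlinarith [ih (by omega)]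
    have hm := hpos m (by omega)
    calc krawtchouk a b (m + i) * r ^ (m + i) ≤ (krawtchouk a b m * D ^ i) * (r ^ m * 1) := by
          rw [pow_add]
          gcongr
          · exact hup i le_rfl
          · exact pow_le_one₀ hr0.le hr1
      _ ≤ (krawtchouk a b m * D ^ L) * (r ^ m * 1) := by gcongr; omega
      _ = _ := by ring
  · obtain ⟨i, rfl⟩ := Nat.exists_eq_add_of_le hle
    have hup : ∀ j ≤ i, krawtchouk a b k ≤ krawtchouk a b (k + j) := by
      intro j
      induction j with
      | zero => simp
      | succ j ih =>
        intro hj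
        have h0 := hpos (k + j) (by omega)
        have hj' : ((k + j : ℕ) : ℝ) + 1 ≤ ((k + i : ℕ) : ℝ) + L + 1 := by
          have : ((k + j : ℕ) : ℝ) ≤ ((k + i + L : ℕ) : ℝ) := by exact_mod_cast (by omega)
          push_cast at this ⊢; linarith
        have h1 := (hratio (k + j) hj').2.1
        rw [← add_assoc]
        nlinarith [ih (by omega)]
    have hm := hpos (k + i) (by omega)
    calc krawtchouk a b k * r ^ k ≤ krawtchouk a b (k + i) * r ^ k * 1 := by
          rw [mul_one]; gcongr; exact hup i le_rfl
      _ ≤ krawtchouk a b (k + i) * r ^ k * (D * r) ^ i := by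
          gcongr; exact one_le_pow₀ hDr
      _ = krawtchouk a b (k + i) * r ^ (k + i) * D ^ i := by rw [mul_pow, pow_add]; ring
      _ ≤ _ := by gcongr; omega

theorem pow_mul_pow_le_sum {a b m L : ℕ} {c r r₁ r₂ D : ℝ} (hc : 1 ≤ c)
    (hκ : (m : ℝ) + L + 1 ≤ a + b)
    (h : ((a : ℝ) + b + 2) / c + (m + L + 1) * (c - 1 / c) ≤ b - a)
    (hDr : 1 ≤ D * r) (hDm : (a : ℝ) + b ≤ D * (m + 1))
    (hr₁ : 0 < r₁) (hr₁r : r₁ < r) (hrr₂ : r < r₂) (hr₂ : r₂ < 1)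
    (ha₁ : (a : ℝ) * (1 + r₁) ^ 2 ≤ b * (1 - r₁) ^ 2)
    (ha₂ : (a : ℝ) * (1 + r₂) ^ 2 ≤ b * (1 - r₂) ^ 2) :
    (1 - r) ^ a * (1 + r) ^ b ≤ (a + b + 1) * (krawtchouk a b m * r ^ m * D ^ L +
      (1 - r₁) ^ a * (1 + r₁) ^ b * ((r / r₁) ^ m * (r₁ / r) ^ L) +
      (1 - r₂) ^ a * (1 + r₂) ^ b * ((r / r₂) ^ m * (r / r₂) ^ L)) := by
  have hr0 : 0 < r := hr₁.trans hr₁r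
  have hr1 : r < 1 := hrr₂.trans hr₂
  have hr₂0 : 0 < r₂ := hr0.trans hrr₂
  have hD0 : 0 < D := by by_contra!; nlinarith
  have hKm : 0 < krawtchouk a b m := (krawtchouk_ratio hc hκ h m (by simp)).1
  have s1 : 0 < 1 - r₁ := by linarith
  have s2 : 0 < 1 - r₂ := by linarith
  have t1 : 0 ≤ krawtchouk a b m * r ^ m * D ^ L := by positivity
  have t2 : 0 ≤ (1 - r₁) ^ a * (1 + r₁) ^ b * ((r / r₁) ^ m * (r₁ / r) ^ L) := by positivity
  have t3 : 0 ≤ (1 - r₂) ^ a * (1 + r₂) ^ b * ((r / r₂) ^ m * (r / r₂) ^ L) := by positivity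
  have htail : ∀ (k : ℕ) (ρ : ℝ), 0 < ρ → ρ < 1 → (a : ℝ) * (1 + ρ) ^ 2 ≤ b * (1 - ρ) ^ 2 →
      krawtchouk a b k * r ^ k ≤ (1 - ρ) ^ a * (1 + ρ) ^ b * (r / ρ) ^ k := by
    intro k ρ hρ hρ1 hab
    calc krawtchouk a b k * r ^ k ≤ |krawtchouk a b k| * r ^ k := by gcongr; exact le_abs_self _
      _ = |krawtchouk a b k| * ρ ^ k * (r / ρ) ^ k := by rw [div_pow]; field_simp
      _ ≤ _ := mul_le_mul_of_nonneg_right (abs_krawtchouk_mul_pow_le a b k hρ hρ1 hab)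
        (by positivity)
  rw [← sum_krawtchouk_mul_pow]
  refine (sum_le_card_nsmul _ _ _ fun k _ => ?_).trans_eq
    (by rw [card_range, nsmul_eq_mul]; push_cast; rfl)
  by_cases hk1 : k + L < m
  · have hlow : (r / r₁) ^ k ≤ (r / r₁) ^ m * (r₁ / r) ^ L := by
      have : (r / r₁) ^ k = (r / r₁) ^ (k + L) * (r₁ / r) ^ L := by
        rw [pow_add, mul_assoc, ← mul_pow, div_mul_div_cancel₀ hr₁.ne', div_self hr0.ne', one_pow,
          mul_one]
      rw [this]
      gcongr
      exact (one_le_div hr₁).2 hr₁r.le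
    have := htail k r₁ hr₁ (hr₁r.trans hr1) ha₁
    have : (1 - r₁) ^ a * (1 + r₁) ^ b * (r / r₁) ^ k ≤
        (1 - r₁) ^ a * (1 + r₁) ^ b * ((r / r₁) ^ m * (r₁ / r) ^ L) := by gcongr
    linarith
  by_cases hk2 : m + L < k
  · have hup : (r / r₂) ^ k ≤ (r / r₂) ^ m * (r / r₂) ^ L := by
      rw [← pow_add]
      exact pow_le_pow_of_le_one (by positivity) ((div_le_one hr₂0).2 hrr₂.le) hk2.le
    have := htail k r₂ hr₂0 hr₂ ha₂
    have : (1 - r₂) ^ a * (1 + r₂) ^ b * (r / r₂) ^ k ≤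
        (1 - r₂) ^ a * (1 + r₂) ^ b * ((r / r₂) ^ m * (r / r₂) ^ L) := by gcongr
    linarith
  · have := krawtchouk_mul_pow_le hc hκ h hr0 hr1.le hDr hDm (k := k) (by omega) (by omega)
    linarith

/-- The exponential growth rate of `(1 - x) ^ a * (1 + x) ^ b / x ^ m` when `a ≈ τ n`,
`b ≈ (1 - τ) n` and `m ≈ ω n`. -/
noncomputable def saddleExponent (ω τ x : ℝ) : ℝ :=
  τ * Real.log (1 - x) + (1 - τ) * Real.log (1 + x) - ω * Real.log x

theorem hasDerivAt_saddleExponent {ω τ r : ℝ} (hr0 : 0 < r) (hr1 : r < 1)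
    (hq : (1 - ω) * r ^ 2 - (1 - 2 * τ) * r + ω = 0) :
    HasDerivAt (saddleExponent ω τ) 0 r := by
  have h1 : (1 - r) ≠ 0 := by linarith
  have h2 : (1 + r) ≠ 0 := by linarith
  have d1 := (((hasDerivAt_id r).const_sub 1).log h1).const_mul τ
  have d2 := (((hasDerivAt_id r).const_add 1).log h2).const_mul (1 - τ)
  have d3 := (Real.hasDerivAt_log hr0.ne').const_mul ω
  have := (d1.add d2).sub d3
  refine this.congr_deriv ?_
  simp only [id]
  field_simp
  linear_combination -hq

theorem exists_saddleExponent_lt_left {ω τ r δ : ℝ} (hr0 : 0 < r) (hr1 : r < 1)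
    (hq : (1 - ω) * r ^ 2 - (1 - 2 * τ) * r + ω = 0) (hδ : 0 < δ) :
    ∃ x, 0 < x ∧ x < r ∧
      saddleExponent ω τ x + δ * Real.log (x / r) < saddleExponent ω τ r := by
  have hd := (hasDerivAt_saddleExponent hr0 hr1 hq).add
    ((Real.hasDerivAt_log hr0.ne').const_mul δ)
  have hpos : 0 < 0 + δ * r⁻¹ := by positivity
  have h := (hasDerivAt_iff_tendsto_slope.1 hd).eventually (lt_mem_nhds hpos)
  have h' := h.filter_mono (nhdsWithin_mono r (s := Set.Iio r) fun x hx => ne_of_lt hx)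
  have h0 : ∀ᶠ x in nhdsWithin r (Set.Iio r), 0 < x :=
    (lt_mem_nhds hr0).filter_mono nhdsWithin_le_nhds
  obtain ⟨x, hx, hx0, hxr⟩ := (h'.and (h0.and self_mem_nhdsWithin)).exists
  have hxr : x < r := hxr
  refine ⟨x, hx0, hxr, ?_⟩
  rw [slope_def_field, div_pos_iff] at hx
  rw [Real.log_div hx0.ne' hr0.ne']
  simp only [Pi.add_apply] at hx
  rcases hx with hx | hx <;> linarith

theorem exists_saddleExponent_lt_right {ω τ r δ : ℝ} (hr0 : 0 < r) (hr1 : r < 1)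
    (hq : (1 - ω) * r ^ 2 - (1 - 2 * τ) * r + ω = 0) (hδ : 0 < δ)
    {p : ℝ → Prop} (hp : ∀ᶠ x in nhds r, p x) :
    ∃ x, r < x ∧ p x ∧
      saddleExponent ω τ x + δ * Real.log (r / x) < saddleExponent ω τ r := by
  have hd := (hasDerivAt_saddleExponent hr0 hr1 hq).sub
    ((Real.hasDerivAt_log hr0.ne').const_mul δ)
  have hneg : 0 - δ * r⁻¹ < 0 := by rw [zero_sub, neg_lt_zero]; positivity
  have h := (hasDerivAt_iff_tendsto_slope.1 hd).eventually (gt_mem_nhds hneg)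
  have h' := h.filter_mono (nhdsWithin_mono r (s := Set.Ioi r) fun x hx => ne_of_gt hx)
  have h0 : ∀ᶠ x in nhdsWithin r (Set.Ioi r), p x := hp.filter_mono nhdsWithin_le_nhds
  obtain ⟨x, hx, hx0, hxr⟩ := (h'.and (h0.and self_mem_nhdsWithin)).exists
  have hxr : r < x := hxr
  refine ⟨x, hxr, hx0, ?_⟩
  rw [slope_def_field, div_neg_iff] at hx
  rw [Real.log_div hr0.ne' (hr0.trans hxr).ne']
  simp only [Pi.sub_apply] at hx
  rcases hx with hx | hx <;> linarith

theorem two_mul_lt_of_root {ω τ r : ℝ} (hr0 : 0 < r) (hr1 : r < 1)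
    (hq : (1 - ω) * r ^ 2 - (1 - 2 * τ) * r + ω = 0) (hlt : (1 - ω) * r ^ 2 < ω) :
    τ * (1 + r) ^ 2 < (1 - τ) * (1 - r) ^ 2 := by
  have h : 0 < (1 - r ^ 2) * (ω - (1 - ω) * r ^ 2) :=
    mul_pos (by nlinarith) (by linarith)
  have h2 : 0 < r * ((1 - 2 * τ) * (1 + r ^ 2) - 2 * r) := by nlinarith
  have := pos_of_mul_pos_right h2 hr0.le
  linarith

theorem exists_ratio_of_root {ω τ r : ℝ} (hω0 : 0 < ω) (hω : ω < 1 / 2) (hr0 : 0 < r)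
    (hq : (1 - ω) * r ^ 2 - (1 - 2 * τ) * r + ω = 0) (hlt : (1 - ω) * r ^ 2 < ω) :
    ∃ c, 1 ≤ c ∧ 1 / c + ω * (c - 1 / c) < 1 - 2 * τ := by
  set c := Real.sqrt ((1 - ω) / ω) with hcdef
  have hc2 : c ^ 2 * ω = 1 - ω := by
    rw [hcdef, Real.sq_sqrt (by apply div_nonneg <;> linarith)]; field_simp
  have hc1 : 1 ≤ c := by
    rw [hcdef, Real.one_le_sqrt, one_le_div hω0]; linarith
  refine ⟨c, hc1, ?_⟩
  have hc0 : 0 < c := by linarith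
  have h1 : 1 / c + ω * (c - 1 / c) = 2 * ω * c := by
    field_simp
    linear_combination -hc2
  rw [h1]
  have hne : (c * r - 1) ≠ 0 := by
    intro h0
    have : c * r = 1 := by linarith
    have : (1 - ω) * r ^ 2 = ω := by
      rw [← hc2]; linear_combination ω * (c * r + 1) * this
    linarith
  have h2 : 0 < ω * (c * r - 1) ^ 2 := by positivity
  have h3 : r * (2 * ω * c) < r * (1 - 2 * τ) := by
    have : c ^ 2 * ω * r ^ 2 = (1 - ω) * r ^ 2 := by rw [hc2]
    nlinarith
  exact lt_of_mul_lt_mul_left h3 hr0.le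

/-- The logarithm of `(1 - x) ^ a * (1 + x) ^ b / x ^ m`. -/
noncomputable def logMajorant (a b m : ℕ) (x : ℝ) : ℝ :=
  a * Real.log (1 - x) + b * Real.log (1 + x) - m * Real.log x

theorem exp_logMajorant (a b m : ℕ) {x : ℝ} (hx0 : 0 < x) (hx1 : x < 1) :
    Real.exp (logMajorant a b m x) = (1 - x) ^ a * (1 + x) ^ b / x ^ m := by
  rw [logMajorant, Real.exp_sub, Real.exp_add, Real.exp_nat_mul, Real.exp_nat_mul,
    Real.exp_nat_mul, Real.exp_log (by linarith), Real.exp_log (by linarith), Real.exp_log hx0]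

theorem exp_logMajorant_le_sum {a b m L : ℕ} {c r r₁ r₂ D : ℝ} (hc : 1 ≤ c)
    (hκ : (m : ℝ) + L + 1 ≤ a + b)
    (h : ((a : ℝ) + b + 2) / c + (m + L + 1) * (c - 1 / c) ≤ b - a)
    (hDr : 1 ≤ D * r) (hDm : (a : ℝ) + b ≤ D * (m + 1))
    (hr₁ : 0 < r₁) (hr₁r : r₁ < r) (hrr₂ : r < r₂) (hr₂ : r₂ < 1)
    (ha₁ : (a : ℝ) * (1 + r₁) ^ 2 ≤ b * (1 - r₁) ^ 2)
    (ha₂ : (a : ℝ) * (1 + r₂) ^ 2 ≤ b * (1 - r₂) ^ 2) :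
    Real.exp (logMajorant a b m r) ≤ (a + b + 1) * (krawtchouk a b m * D ^ L +
      Real.exp (logMajorant a b m r₁ + L * Real.log (r₁ / r)) +
      Real.exp (logMajorant a b m r₂ + L * Real.log (r / r₂))) := by
  have hr0 : 0 < r := hr₁.trans hr₁r
  have hr1 : r < 1 := hrr₂.trans hr₂
  have hr₂0 : 0 < r₂ := hr0.trans hrr₂
  rw [Real.exp_add, Real.exp_add, exp_logMajorant a b m hr0 hr1,
    exp_logMajorant a b m hr₁ (hr₁r.trans hr1), exp_logMajorant a b m hr₂0 hr₂,
    Real.exp_nat_mul, Real.exp_nat_mul, Real.exp_log (by positivity), Real.exp_log (by positivity),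
    div_le_iff₀ (by positivity)]
  refine (pow_mul_pow_le_sum hc hκ h hDr hDm hr₁ hr₁r hrr₂ hr₂ ha₁ ha₂).trans_eq ?_
  rw [div_pow r r₁ m, div_pow r r₂ m]
  ring

theorem log_krawtchouk_le {a b m : ℕ} {r : ℝ} (hr0 : 0 < r) (hr1 : r < 1)
    (h : (a : ℝ) * (1 + r) ^ 2 ≤ b * (1 - r) ^ 2) (hK : 0 < krawtchouk a b m) :
    Real.log (krawtchouk a b m) ≤ logMajorant a b m r := by
  rw [Real.log_le_iff_le_exp hK, exp_logMajorant a b m hr0 hr1, le_div_iff₀ (by positivity)]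
  exact (mul_le_mul_of_nonneg_right (le_abs_self _) (by positivity)).trans
    (abs_krawtchouk_mul_pow_le a b m hr0 hr1 h)

theorem eventually_linear_lt_exp {η : ℝ} (hη : 0 < η) :
    ∀ᶠ n : ℕ in atTop, 3 * (2 * (n : ℝ) + 1) < Real.exp (η * n) := by
  filter_upwards [eventually_gt_atTop 0,
    tendsto_natCast_atTop_atTop.eventually_gt_atTop (18 / η ^ 2)] with n hn hn2
  have hn' : (1 : ℝ) ≤ n := by exact_mod_cast hn
  have h := Real.quadratic_le_exp_of_nonneg (x := η * n) (by positivity)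
  rw [div_lt_iff₀ (by positivity)] at hn2
  have : 0 < η * n := by positivity
  nlinarith

section Asymptotics

variable {a b m : ℕ → ℕ} {ω τ r : ℝ}

theorem tendsto_logMajorant_div (ha : Tendsto (fun n => (a n : ℝ) / n) atTop (nhds τ))
    (hb : Tendsto (fun n => (b n : ℝ) / n) atTop (nhds (1 - τ)))
    (hm : Tendsto (fun n => (m n : ℝ) / n) atTop (nhds ω)) (x : ℝ) :
    Tendsto (fun n => logMajorant (a n) (b n) (m n) x / n) atTop
      (nhds (saddleExponent ω τ x)) := by
  refine (((ha.mul_const (Real.log (1 - x))).add (hb.mul_const (Real.log (1 + x)))).sub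
    (hm.mul_const (Real.log x))).congr fun n => ?_
  rw [logMajorant]; ring

theorem eventually_contour (ha : Tendsto (fun n => (a n : ℝ) / n) atTop (nhds τ))
    (hb : Tendsto (fun n => (b n : ℝ) / n) atTop (nhds (1 - τ))) {x : ℝ}
    (hx : τ * (1 + x) ^ 2 < (1 - τ) * (1 - x) ^ 2) :
    ∀ᶠ n in atTop, (a n : ℝ) * (1 + x) ^ 2 ≤ b n * (1 - x) ^ 2 := by
  filter_upwards [(ha.mul_const _).eventually_lt (hb.mul_const _) hx, eventually_gt_atTop 0]
    with n h hn
  have hn' : (0 : ℝ) < n := by exact_mod_cast hn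
  rw [div_mul_eq_mul_div, div_mul_eq_mul_div, div_lt_div_iff_of_pos_right hn'] at h
  exact h.le

theorem eventually_sub_lt_log_krawtchouk_div
    (ha : Tendsto (fun n => (a n : ℝ) / n) atTop (nhds τ))
    (hb : Tendsto (fun n => (b n : ℝ) / n) atTop (nhds (1 - τ)))
    (hm : Tendsto (fun n => (m n : ℝ) / n) atTop (nhds ω))
    (hτ : 0 ≤ τ) (hω0 : 0 < ω) (hω : ω < 1 / 2) (hr0 : 0 < r) (hr1 : r < 1)
    (hq : (1 - ω) * r ^ 2 - (1 - 2 * τ) * r + ω = 0) (hlt : (1 - ω) * r ^ 2 < ω)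
    {ε : ℝ} (hε : 0 < ε) :
    ∀ᶠ n in atTop, 0 < krawtchouk (a n) (b n) (m n) ∧
      saddleExponent ω τ r - ε < Real.log (krawtchouk (a n) (b n) (m n)) / n := by
  obtain ⟨c, hc1, hc⟩ := exists_ratio_of_root hω0 hω hr0 hq hlt
  set D : ℝ := 2 / (ω * r) with hD
  have hD0 : 0 < D := by positivity
  have hDr : 1 ≤ D * r := by
    rw [hD, div_mul_eq_mul_div, one_le_div (by positivity)]; nlinarith
  have hDω : 1 < D * ω := by
    rw [hD, div_mul_eq_mul_div, one_lt_div (by positivity)]; nlinarith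
  obtain ⟨δ, ⟨hδD, hδω, hδc⟩, hδ⟩ : ∃ δ : ℝ, (δ * Real.log D < ε / 2 ∧ ω + δ < 1 ∧
      1 / c + (ω + δ) * (c - 1 / c) < 1 - 2 * τ) ∧ 0 < δ := by
    have h1 : ∀ᶠ δ : ℝ in nhds 0, δ * Real.log D < ε / 2 :=
      ContinuousAt.eventually_lt (by fun_prop) (by fun_prop) (by simpa using hε)
    have h2 : ∀ᶠ δ : ℝ in nhds 0, ω + δ < 1 :=
      ContinuousAt.eventually_lt (by fun_prop) (by fun_prop) (by linarith)
    have h3 : ∀ᶠ δ : ℝ in nhds 0, 1 / c + (ω + δ) * (c - 1 / c) < 1 - 2 * τ :=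
      ContinuousAt.eventually_lt (by fun_prop) (by fun_prop) (by simpa using hc)
    exact (((h1.and (h2.and h3)).filter_mono nhdsWithin_le_nhds).and
      (self_mem_nhdsWithin (s := Set.Ioi (0 : ℝ)))).exists
  have hcontour := two_mul_lt_of_root hr0 hr1 hq hlt
  obtain ⟨r₁, hr₁, hr₁r, hγ₁⟩ := exists_saddleExponent_lt_left hr0 hr1 hq hδ
  obtain ⟨r₂, hrr₂, ⟨hr₂, hcontour₂⟩, hγ₂⟩ :=
    exists_saddleExponent_lt_right hr0 hr1 hq hδ
      (p := fun x => x < 1 ∧ τ * (1 + x) ^ 2 < (1 - τ) * (1 - x) ^ 2)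
      ((gt_mem_nhds hr1).and
        (ContinuousAt.eventually_lt (by fun_prop) (by fun_prop) hcontour))
  have hτ1 : 0 < 1 - τ := by
    by_contra! h0
    nlinarith [mul_nonneg hτ (sq_nonneg (1 + r)), mul_nonneg (neg_nonneg.2 h0) (sq_nonneg (1 - r))]
  have hcontour₁ : τ * (1 + r₁) ^ 2 < (1 - τ) * (1 - r₁) ^ 2 := by
    calc τ * (1 + r₁) ^ 2 ≤ τ * (1 + r) ^ 2 := by gcongr
      _ < (1 - τ) * (1 - r) ^ 2 := hcontour
      _ ≤ (1 - τ) * (1 - r₁) ^ 2 := by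
        have : 0 ≤ 1 - r := by linarith
        gcongr
  set Γ := saddleExponent ω τ r with hΓ
  obtain ⟨η, hη, hηε, hη₁, hη₂⟩ : ∃ η : ℝ, 0 < η ∧ η ≤ ε / 4 ∧
      saddleExponent ω τ r₁ + δ * Real.log (r₁ / r) < Γ - 2 * η ∧
      saddleExponent ω τ r₂ + δ * Real.log (r / r₂) < Γ - 2 * η := by
    have h1 : ∀ᶠ η : ℝ in nhds 0, η < ε / 4 := gt_mem_nhds (by linarith)
    have h2 : ∀ᶠ η : ℝ in nhds 0,
        saddleExponent ω τ r₁ + δ * Real.log (r₁ / r) < Γ - 2 * η :=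
      ContinuousAt.eventually_lt (by fun_prop) (by fun_prop) (by simpa using hγ₁)
    have h3 : ∀ᶠ η : ℝ in nhds 0,
        saddleExponent ω τ r₂ + δ * Real.log (r / r₂) < Γ - 2 * η :=
      ContinuousAt.eventually_lt (by fun_prop) (by fun_prop) (by simpa using hγ₂)
    obtain ⟨η, ⟨h1, h2, h3⟩, h0⟩ :=
      (((h1.and (h2.and h3)).filter_mono nhdsWithin_le_nhds).and
        (self_mem_nhdsWithin (s := Set.Ioi (0 : ℝ)))).exists
    exact ⟨η, h0, h1.le, h2, h3⟩
  have hL : Tendsto (fun n : ℕ => (⌊δ * n⌋₊ : ℝ) / n) atTop (nhds δ) :=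
    (tendsto_nat_floor_mul_div_atTop hδ.le).comp tendsto_natCast_atTop_atTop
  have hinv : ∀ C : ℝ, Tendsto (fun n : ℕ => C / (n : ℝ)) atTop (nhds 0) :=
    fun C => tendsto_const_div_atTop_nhds_zero_nat C
  have e1 : ∀ᶠ n in atTop, (logMajorant (a n) (b n) (m n) r₁ +
      (⌊δ * (n : ℝ)⌋₊ : ℝ) * Real.log (r₁ / r)) / n < Γ - 2 * η := by
    refine (((tendsto_logMajorant_div ha hb hm r₁).add (hL.mul_const _)).congr
      fun n => ?_).eventually_lt_const hη₁
    ring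
  have e2 : ∀ᶠ n in atTop, (logMajorant (a n) (b n) (m n) r₂ +
      (⌊δ * (n : ℝ)⌋₊ : ℝ) * Real.log (r / r₂)) / n < Γ - 2 * η := by
    refine (((tendsto_logMajorant_div ha hb hm r₂).add (hL.mul_const _)).congr
      fun n => ?_).eventually_lt_const hη₂
    ring
  have e3 : ∀ᶠ n in atTop, Γ - η < logMajorant (a n) (b n) (m n) r / n :=
    (tendsto_logMajorant_div ha hb hm r).eventually_const_lt (by linarith)
  have e4 : ∀ᶠ n : ℕ in atTop, (⌊δ * (n : ℝ)⌋₊ : ℝ) / n * Real.log D < ε / 2 :=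
    (hL.mul_const _).eventually_lt_const hδD
  have hab : Tendsto (fun n => (a n : ℝ) / n + (b n : ℝ) / n) atTop (nhds 1) := by
    simpa using ha.add hb
  have e5 : ∀ᶠ n in atTop, (a n : ℝ) / n + (b n : ℝ) / n < 2 :=
    hab.eventually_lt_const (by norm_num)
  have e6 : ∀ᶠ n in atTop, (m n : ℝ) / n + (⌊δ * (n : ℝ)⌋₊ : ℝ) / n + 1 / n <
      (a n : ℝ) / n + (b n : ℝ) / n :=
    ((hm.add hL).add (hinv 1)).eventually_lt hab (by linarith)
  have e7 : ∀ᶠ n in atTop, ((a n : ℝ) / n + (b n : ℝ) / n + 2 / n) * (1 / c) +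
      ((m n : ℝ) / n + (⌊δ * (n : ℝ)⌋₊ : ℝ) / n + 1 / n) * (c - 1 / c) <
      (b n : ℝ) / n - (a n : ℝ) / n :=
    (((hab.add (hinv 2)).mul_const _).add (((hm.add hL).add (hinv 1)).mul_const _)).eventually_lt
      (hb.sub ha) (by linarith)
  have e8 : ∀ᶠ n in atTop, (a n : ℝ) / n + (b n : ℝ) / n < D * ((m n : ℝ) / n) :=
    hab.eventually_lt (hm.const_mul D) hDω
  filter_upwards [e1, e2, e3, e4, e5, e6, e7, e8, eventually_contour ha hb hcontour₁,
    eventually_contour ha hb hcontour₂, eventually_linear_lt_exp hη, eventually_gt_atTop 0]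
    with n e1 e2 e3 e4 e5 e6 e7 e8 e9 e10 e11 hn
  have hn' : (0 : ℝ) < n := by exact_mod_cast hn
  set L := ⌊δ * (n : ℝ)⌋₊
  have f5 : (a n : ℝ) + b n < 2 * n := by
    rwa [← add_div, div_lt_iff₀ hn'] at e5
  have f6 : (m n : ℝ) + L + 1 ≤ a n + b n := by
    rw [← add_div, ← add_div, ← add_div, div_lt_div_iff_of_pos_right hn'] at e6
    exact e6.le
  have f7 : ((a n : ℝ) + b n + 2) / c + (m n + L + 1) * (c - 1 / c) ≤ b n - a n := by
    have := mul_lt_mul_of_pos_right e7 hn'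
    refine le_of_lt ?_
    convert this using 1 <;> field_simp
  have f8 : (a n : ℝ) + b n ≤ D * (m n + 1) := by
    rw [← add_div, ← mul_div_assoc, div_lt_div_iff_of_pos_right hn'] at e8
    linarith
  have hK : 0 < krawtchouk (a n) (b n) (m n) := (krawtchouk_ratio hc1 f6 f7 (m n) (by simp)).1
  refine ⟨hK, ?_⟩
  by_contra! hcon
  have hsum := exp_logMajorant_le_sum hc1 f6 f7 hDr f8 hr₁ hr₁r hrr₂ hr₂ e9 e10
  rw [div_lt_iff₀ hn'] at e1 e2
  rw [lt_div_iff₀ hn'] at e3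
  have hKD : krawtchouk (a n) (b n) (m n) * D ^ L ≤ Real.exp ((Γ - 2 * η) * n) := by
    have : Real.log (krawtchouk (a n) (b n) (m n)) + L * Real.log D =
        (Real.log (krawtchouk (a n) (b n) (m n)) / n + L / n * Real.log D) * n := by
      field_simp
    rw [← Real.log_le_iff_le_exp (by positivity), Real.log_mul hK.ne' (by positivity),
      Real.log_pow, this]
    gcongr
    linarith
  have h1 := Real.exp_le_exp.2 e1.le
  have h2 := Real.exp_le_exp.2 e2.le
  have h3 := Real.exp_lt_exp.2 e3
  have hE := Real.exp_pos ((Γ - 2 * η) * n)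
  have hchain : Real.exp ((Γ - η) * n) < Real.exp (η * n) * Real.exp ((Γ - 2 * η) * n) := by
    calc Real.exp ((Γ - η) * n) < _ := h3
      _ ≤ _ := hsum
      _ ≤ (2 * n + 1) * (Real.exp ((Γ - 2 * η) * n) + Real.exp ((Γ - 2 * η) * n) +
          Real.exp ((Γ - 2 * η) * n)) := by gcongr
      _ = 3 * (2 * (n : ℝ) + 1) * Real.exp ((Γ - 2 * η) * n) := by ring
      _ ≤ _ := by gcongr
  rw [← Real.exp_add] at hchain
  exact hchain.ne (by ring_nf)

theorem tendsto_log_krawtchouk_div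
    (ha : Tendsto (fun n => (a n : ℝ) / n) atTop (nhds τ))
    (hb : Tendsto (fun n => (b n : ℝ) / n) atTop (nhds (1 - τ)))
    (hm : Tendsto (fun n => (m n : ℝ) / n) atTop (nhds ω))
    (hτ : 0 ≤ τ) (hω0 : 0 < ω) (hω : ω < 1 / 2) (hr0 : 0 < r) (hr1 : r < 1)
    (hq : (1 - ω) * r ^ 2 - (1 - 2 * τ) * r + ω = 0) (hlt : (1 - ω) * r ^ 2 < ω) :
    Tendsto (fun n => Real.log (krawtchouk (a n) (b n) (m n)) / n) atTop
      (nhds (saddleExponent ω τ r)) := by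
  have hlow := fun {ε : ℝ} (hε : 0 < ε) =>
    eventually_sub_lt_log_krawtchouk_div ha hb hm hτ hω0 hω hr0 hr1 hq hlt hε
  refine tendsto_order.2 ⟨fun x hx => ?_, fun x hx => ?_⟩
  · filter_upwards [hlow (sub_pos.2 hx)] with n hn
    simpa using hn.2
  · filter_upwards [hlow one_pos,
      eventually_contour ha hb (two_mul_lt_of_root hr0 hr1 hq hlt),
      (tendsto_logMajorant_div ha hb hm r).eventually_lt_const hx] with n h1 h2 h3
    refine lt_of_le_of_lt ?_ h3
    gcongr
    exact log_krawtchouk_le hr0 hr1 h2 h1.1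

theorem tendsto_log_choose_div {N : ℕ → ℕ}
    (hN : Tendsto (fun n => (N n : ℝ) / n) atTop (nhds 1))
    (hm : Tendsto (fun n => (m n : ℝ) / n) atTop (nhds ω)) (hω0 : 0 < ω) (hω : ω < 1 / 2) :
    Tendsto (fun n => Real.log ((N n).choose (m n)) / n) atTop
      (nhds (-ω * Real.log ω - (1 - ω) * Real.log (1 - ω))) := by
  have h1 : 0 < 1 - ω := by linarith
  have h := tendsto_log_krawtchouk_div (a := fun _ => 0) (b := N) (m := m) (τ := 0)
    (r := ω / (1 - ω)) (by simp) (by simpa using hN) hm le_rfl hω0 hω (by positivity)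
    (by rw [div_lt_one h1]; linarith) (by field_simp; ring)
    (by
      have : (1 - ω) * (ω / (1 - ω)) ^ 2 = ω * (ω / (1 - ω)) := by field_simp
      rw [this]
      have : ω / (1 - ω) < 1 := by rw [div_lt_one h1]; linarith
      nlinarith)
  simp only [krawtchouk_zero_left] at h
  convert h using 2
  have : 1 + ω / (1 - ω) = (1 - ω)⁻¹ := by field_simp; ring
  rw [saddleExponent, this, Real.log_inv, Real.log_div hω0.ne' h1.ne']
  ring

end Asymptotics

theorem tendsto_log_bias_div {ω τ r : ℝ} (hτ0 : 0 < τ) (hτ : τ < 1 / 2) (hω0 : 0 < ω)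
    (hω : ω < 1 / 2) (hr0 : 0 < r) (hr1 : r < 1)
    (hq : (1 - ω) * r ^ 2 - (1 - 2 * τ) * r + ω = 0) (hlt : (1 - ω) * r ^ 2 < ω) :
    Tendsto (fun n : ℕ =>
      Real.log (eps1 n ⌊ω * n⌋₊ ⌊τ * n⌋₊ - eps0 n ⌊ω * n⌋₊ ⌊τ * n⌋₊) / n) atTop
      (nhds (saddleExponent ω τ r - (-ω * Real.log ω - (1 - ω) * Real.log (1 - ω)))) := by
  have hfloor : ∀ {x : ℝ}, 0 < x → Tendsto (fun n : ℕ => (⌊x * n⌋₊ : ℝ) / n) atTop (nhds x) :=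
    fun hx => (tendsto_nat_floor_mul_div_atTop hx.le).comp tendsto_natCast_atTop_atTop
  have hinv : Tendsto (fun n : ℕ => (1 : ℝ) / n) atTop (nhds 0) :=
    tendsto_const_div_atTop_nhds_zero_nat 1
  have hpos : ∀ {x : ℝ}, 0 < x → ∀ᶠ n : ℕ in atTop, 1 ≤ ⌊x * (n : ℝ)⌋₊ := by
    intro x hx
    filter_upwards [(tendsto_natCast_atTop_atTop.const_mul_atTop hx).eventually_ge_atTop 1]
      with n hn
    exact Nat.one_le_floor_iff (x * n) |>.2 hn
  have hhalf : ∀ {x : ℝ}, x < 1 / 2 → ∀ n : ℕ, 2 * ⌊x * (n : ℝ)⌋₊ ≤ n := by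
    intro x hx n
    have h1 : (⌊x * (n : ℝ)⌋₊ : ℝ) ≤ 1 / 2 * n := by
      refine (Nat.cast_le.2 (Nat.floor_le_floor (?_ : x * (n : ℝ) ≤ 1 / 2 * n))).trans
        (Nat.floor_le (by positivity))
      gcongr
    have : ((2 * ⌊x * (n : ℝ)⌋₊ : ℕ) : ℝ) ≤ n := by push_cast; linarith
    exact_mod_cast this
  have hpred : ∀ {x : ℝ}, 0 < x →
      Tendsto (fun n : ℕ => ((⌊x * n⌋₊ - 1 : ℕ) : ℝ) / n) atTop (nhds x) := by
    intro x hx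
    have h := (hfloor hx).sub hinv
    rw [sub_zero] at h
    refine h.congr' ?_
    filter_upwards [hpos hx] with n hn
    rw [Nat.cast_sub hn, Nat.cast_one, sub_div]
  have hone : Tendsto (fun n : ℕ => (n : ℝ) / n) atTop (nhds 1) :=
    tendsto_const_nhds.congr' (by
      filter_upwards [eventually_gt_atTop 0] with n hn
      rw [div_self (by exact_mod_cast hn.ne')])
  have hb : Tendsto (fun n : ℕ => ((n - 1 - ⌊τ * n⌋₊ : ℕ) : ℝ) / n) atTop (nhds (1 - τ)) := by
    have h := (hone.sub hinv).sub (hfloor hτ0)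
    rw [sub_zero] at h
    refine h.congr' ?_
    filter_upwards [eventually_ge_atTop 2] with n hn
    have := hhalf hτ n
    rw [Nat.cast_sub (by omega), Nat.cast_sub (by omega), Nat.cast_one, sub_div, sub_div]
  have hN : Tendsto (fun n : ℕ => ((n - 1 : ℕ) : ℝ) / n) atTop (nhds 1) := by
    have h := hone.sub hinv
    rw [sub_zero] at h
    refine h.congr' ?_
    filter_upwards [eventually_ge_atTop 1] with n hn
    rw [Nat.cast_sub hn, Nat.cast_one, sub_div]
  have hK := tendsto_log_krawtchouk_div (hpred hτ0) hb (hpred hω0) hτ0.le hω0 hω hr0 hr1 hq hlt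
  have hC := tendsto_log_choose_div hN (hpred hω0) hω0 hω
  have hKpos := eventually_sub_lt_log_krawtchouk_div (hpred hτ0) hb (hpred hω0) hτ0.le hω0 hω
    hr0 hr1 hq hlt one_pos
  refine (hK.sub hC).congr' ?_
  filter_upwards [hKpos, hpos hτ0, hpos hω0, eventually_ge_atTop 2] with n hn ht hw hn2
  have ht2 := hhalf hτ n
  have hw2 := hhalf hω n
  set t := ⌊τ * (n : ℝ)⌋₊
  set w := ⌊ω * (n : ℝ)⌋₊
  have h := eps1_sub_eps0 (t - 1) (n - 1 - t) (w - 1) (by omega)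
  rw [show t - 1 + (n - 1 - t) + 2 = n by omega, show t - 1 + 1 = t by omega,
    show w - 1 + 1 = w by omega, show t - 1 + (n - 1 - t) + 1 = n - 1 by omega] at h
  have hchoose : (((n - 1).choose (w - 1) : ℕ) : ℝ) ≠ 0 := by
    exact_mod_cast (Nat.choose_pos (by omega)).ne'
  rw [h, Real.log_div hn.1.ne' hchoose, sub_div]

theorem smallest_root_properties {ω τ r : ℝ} (hω0 : 0 < ω) (hω : ω < 1 / 2) (hτ0 : 0 < τ)
    (hτ : τ < 1 / 2 - Real.sqrt (ω - ω ^ 2))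
    (hr : r = (1 - 2 * τ - Real.sqrt ((1 - 2 * τ) ^ 2 - 4 * ω * (1 - ω))) / (2 * (1 - ω))) :
    0 < r ∧ r < 1 ∧ (1 - ω) * r ^ 2 - (1 - 2 * τ) * r + ω = 0 ∧ (1 - ω) * r ^ 2 < ω := by
  have h1 : 0 < 1 - ω := by linarith
  have hs := Real.sq_sqrt (show 0 ≤ ω - ω ^ 2 by nlinarith)
  have hs0 := Real.sqrt_nonneg (ω - ω ^ 2)
  have hdisc : 0 < (1 - 2 * τ) ^ 2 - 4 * ω * (1 - ω) := by nlinarith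
  set d := Real.sqrt ((1 - 2 * τ) ^ 2 - 4 * ω * (1 - ω)) with hd
  have hd0 : 0 < d := Real.sqrt_pos.2 hdisc
  have hd2 : d ^ 2 = (1 - 2 * τ) ^ 2 - 4 * ω * (1 - ω) := Real.sq_sqrt hdisc.le
  have hr' : 2 * (1 - ω) * r = 1 - 2 * τ - d := by rw [hr]; field_simp
  have hdlt : d < 1 - 2 * τ := lt_of_pow_lt_pow_left₀ 2 (by linarith) (by nlinarith)
  have hr0 : 0 < r := by rw [hr]; apply div_pos <;> linarith
  have hq : (1 - ω) * r ^ 2 - (1 - 2 * τ) * r + ω = 0 := by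
    have : 4 * (1 - ω) * ((1 - ω) * r ^ 2 - (1 - 2 * τ) * r + ω) = 0 := by
      linear_combination (2 * (1 - ω) * r - d - (1 - 2 * τ)) * hr' + hd2
    exact (mul_eq_zero.1 this).resolve_left (by positivity)
  have hlt : (1 - ω) * r ^ 2 < ω := by nlinarith
  refine ⟨hr0, ?_, hq, hlt⟩
  by_contra! h
  nlinarith

end Krawtchouk

/-- in the real regime `0 < τ < 1/2 − √(ω−ω²)`, with `r` the
smallest root of `(1−ω)X² − (1−2τ)X + ω = 0`,
`π(ω,τ) = 2ω log₂ r − 2τ log₂(1−r) − 2(1−τ) log₂(1+r) + 2H(ω)`. -/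
theorem piSD_real_regime (ω τ : ℝ) (hω0 : 0 < ω) (hω : ω < 1 / 2)
    (hτ0 : 0 < τ) (hτ : τ < 1 / 2 - Real.sqrt (ω - ω ^ 2)) :
    let r : ℝ := (1 - 2 * τ - Real.sqrt ((1 - 2 * τ) ^ 2 - 4 * ω * (1 - ω))) /
      (2 * (1 - ω));
    piSD ω τ = 2 * ω * Real.logb 2 r - 2 * τ * Real.logb 2 (1 - r)
      - 2 * (1 - τ) * Real.logb 2 (1 + r) + 2 * binH ω := by
  intro r
  obtain ⟨hr0, hr1, hq, hlt⟩ := smallest_root_properties hω0 hω hτ0 hτ (r := r) rfl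
  have hτ' : τ < 1 / 2 := by linarith [Real.sqrt_nonneg (ω - ω ^ 2)]
  have h := (tendsto_log_bias_div hτ0 hτ' hω0 hω hr0 hr1 hq hlt).const_mul (-2 / Real.log 2)
  refine Tendsto.liminf_eq ?_
  convert h using 2
  · rw [Real.logb, one_div (_ ^ 2), Real.log_inv, Real.log_pow]
    push_cast
    ring
  · simp only [saddleExponent, binH, Real.logb]
    ring
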